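/- arXiv:2508.15597 — 5 statements merged into one kernel-verified Lean document; each statement's English description precedes it below -/
import Mathlib

section
/- Let p and q be patterns, f a coloring, and H an infinite subset of ℕ which f-avoids the join p ⊎ q. Then there exists an infinite subset Y ⊆ H such that Y f-avoids p or Y f-avoids q. -/
/-- A coloring of pairs of natural numbers (only values at `x < y` are relevant). -/
abbrev Coloring := ℕ → ℕ → Fin 2

/-- A pattern of length `len`: a finite 2-coloring of pairs of indices
(only values at `i < j < len` are relevant). -/
structure Pattern where
  len : ℕ
  color : ℕ → ℕ → Fin 2

/-- The `i`-th element of a finite set of naturals, in increasing order. -/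
def nthElt (F : Finset ℕ) (i : ℕ) : ℕ := (F.sort (· ≤ ·)).getD i 0

/-- The finite set `F = {x₀ < … < x_{k-1}}` `f`-realizes the pattern `p` (of length `k`). -/
def Realizes (f : Coloring) (p : Pattern) (F : Finset ℕ) : Prop :=
  F.card = p.len ∧ ∀ i j, i < j → j < p.len → f (nthElt F i) (nthElt F j) = p.color i j

/-- The set `H` `f`-avoids the pattern `p`: no finite subset of `H` `f`-realizes `p`. -/
def Avoids (f : Coloring) (p : Pattern) (H : Set ℕ) : Prop :=
  ∀ F : Finset ℕ, ↑F ⊆ H → ¬ Realizes f p F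

/-- `p⁻` : the restriction of `p` to the domain `[|p| - 1]²`. -/
def Pattern.minus (p : Pattern) : Pattern := ⟨p.len - 1, p.color⟩

/-- The join `p ⊎ q` of two patterns. -/
def Pattern.join (p q : Pattern) : Pattern where
  len := p.len + q.len - 1
  color := fun x y =>
    if y < p.len then p.color x y
    else if p.len - 1 ≤ x then q.color (x + 1 - p.len) (y + 1 - p.len)
    else p.color x (p.len - 1)

/-- Equality of patterns: same length and same colors on the relevant domain `i < j < len`. -/
def Pattern.EquivP (p q : Pattern) : Prop :=
  p.len = q.len ∧ ∀ x y, x < y → y < p.len → p.color x y = q.color x y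

/-- A pattern is reducible if it is a join of two patterns of length at least 2. -/
def Pattern.Reducible (p : Pattern) : Prop :=
  ∃ p₀ p₁ : Pattern, 2 ≤ p₀.len ∧ 2 ≤ p₁.len ∧ p.EquivP (p₀.join p₁)

/-- A pattern is irreducible if it is not reducible. -/
def Pattern.Irreducible (p : Pattern) : Prop := ¬ p.Reducible

/-- `q` is a sub-pattern of `p` via the strictly increasing embedding `g`. -/
def SubPatternVia (q p : Pattern) (g : ℕ → ℕ) : Prop :=
  StrictMonoOn g (Set.Iio q.len) ∧ (∀ x < q.len, g x < p.len) ∧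
    ∀ x y, x < y → y < q.len → q.color x y = p.color (g x) (g y)

/-- `q` is a sub-pattern of `p`. -/
def SubPattern (q p : Pattern) : Prop := ∃ g, SubPatternVia q p g

/-- A pattern is convergent if its last column is monochromatic. -/
def Pattern.Convergent (p : Pattern) : Prop :=
  ∃ i : Fin 2, ∀ x < p.len - 1, p.color x (p.len - 1) = i

/-- A pattern is divergent if it is not convergent. -/
def Pattern.Divergent (p : Pattern) : Prop := ¬ p.Convergent

/-- `F` `f`-stabilizes `E` with witness `g`. -/
def Stabilizes (f : Coloring) (E F : Set ℕ) (g : ℕ → Fin 2) : Prop :=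
  ∀ x ∈ E, ∀ y ∈ F, f x y = g x

/-- `X` `(f,g)`-avoids `p`. -/
def FGAvoids (f : Coloring) (g : ℕ → Fin 2) (p : Pattern) (X : Set ℕ) : Prop :=
  Avoids f p X ∧ ∀ F : Finset ℕ, ↑F ⊆ X → Realizes f p.minus F →
    ∃ i < p.len - 1, g (nthElt F i) ≠ p.color i (p.len - 1)

/-- `p` is `i`-merging. -/
def Pattern.Merging (p : Pattern) (i : Fin 2) : Prop :=
  ∀ F G : Finset ℕ, F.Nonempty → G.Nonempty → Disjoint F G →
    F ∪ G = Finset.range (p.len - 1) → (∀ x ∈ F, ∀ y ∈ G, x < y) →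
    (∃ x ∈ F, p.color x (p.len - 1) = 1 - i) ∨
    (∃ x ∈ G, p.color x (p.len - 1) = i) ∨
    (∃ x₀ ∈ F, ∃ x₁ ∈ F, ∃ y₀ ∈ G, ∃ y₁ ∈ G, p.color x₀ y₀ ≠ p.color x₁ y₁)

/-- A coloring is stable if `f(x, ·)` is eventually constant for each `x`. -/
def Stable (f : Coloring) : Prop := ∀ x, ∃ c, ∃ N, ∀ y ≥ N, f x y = c

/-- `F` strongly `f`-realizes `p`: `F` realizes `p⁻` and each element has the limit
prescribed by the last column of `p`. -/
def StronglyRealizes (f : Coloring) (p : Pattern) (F : Finset ℕ) : Prop :=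
  Realizes f p.minus F ∧
    ∀ i < p.len - 1, ∃ N, ∀ y ≥ N, f (nthElt F i) y = p.color i (p.len - 1)

/-- The restriction `p↾_S` of a pattern to a finite set of indices. -/
def Pattern.restrict (p : Pattern) (S : Finset ℕ) : Pattern :=
  ⟨S.card, fun i j => p.color (nthElt S i) (nthElt S j)⟩

theorem nthElt_image (n : ℕ) (s : ℕ → ℕ) (hs : ∀ i j, i < j → j < n → s i < s j) :
    ((List.range n).map s).toFinset.card = n ∧
    ∀ i < n, nthElt ((List.range n).map s).toFinset i = s i := by
  have hp : ((List.range n).map s).Pairwise (· < ·) := by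
    rw [List.pairwise_iff_getElem]
    intro i j hi hj hij
    simp only [List.getElem_map, List.getElem_range]
    simp at hj
    exact hs i j hij hj
  have hnd : ((List.range n).map s).Nodup := hp.imp (fun h => ne_of_lt h)
  constructor
  · rw [List.toFinset_card_of_nodup hnd]; simp
  · intro i hi
    unfold nthElt
    rw [(List.toFinset_sort (· ≤ ·) hnd).2 (hp.imp (fun h => le_of_lt h))]
    simp [List.getD, hi]

theorem nthElt_spec (F : Finset ℕ) :
    (∀ i < F.card, nthElt F i ∈ F) ∧
    ∀ i j, i < j → j < F.card → nthElt F i < nthElt F j := by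
  have key : ∀ i (h : i < (F.sort (· ≤ ·)).length), nthElt F i = (F.sort (· ≤ ·))[i] := by
    intro i h
    unfold nthElt
    exact List.getD_eq_getElem _ _ h
  have hl : (F.sort (· ≤ ·)).length = F.card := Finset.length_sort _
  constructor
  · intro i hi
    rw [key i (by omega)]
    exact (Finset.mem_sort (· ≤ ·)).1 (List.getElem_mem _)
  · intro i j hij hj
    rw [key i (by omega), key j (by omega)]
    have hp := Finset.sortedLT_sort F
    exact (List.pairwise_iff_getElem.1 hp.pairwise) i j (by omega) (by omega) hij

/-- `s` enumerates (on `i < n`) a subset of `H` realizing the colors `c`. -/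
def SeqReal (f : Coloring) (n : ℕ) (c : ℕ → ℕ → Fin 2) (H : Set ℕ) (s : ℕ → ℕ) : Prop :=
  (∀ i < n, s i ∈ H) ∧ ∀ i j, i < j → j < n → s i < s j ∧ f (s i) (s j) = c i j

theorem avoids_iff (f : Coloring) (p : Pattern) (H : Set ℕ) :
    Avoids f p H ↔ ∀ s, ¬ SeqReal f p.len p.color H s := by
  constructor
  · rintro h s ⟨h1, h2⟩
    obtain ⟨hc, hn⟩ := nthElt_image p.len s (fun i j a b => (h2 i j a b).1)
    refine h ((List.range p.len).map s).toFinset ?_ ⟨hc, ?_⟩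
    · intro x hx
      simp at hx
      obtain ⟨a, ha, rfl⟩ := hx
      exact h1 a ha
    · intro i j hij hj
      rw [hn i (by omega), hn j hj]
      exact (h2 i j hij hj).2
  · rintro h F hF ⟨hc, hr⟩
    obtain ⟨h1, h2⟩ := nthElt_spec F
    rw [hc] at h1 h2
    exact h (nthElt F) ⟨fun i hi => hF (h1 i hi), fun i j hij hj => ⟨h2 i j hij hj, hr i j hij hj⟩⟩

/-- One-point extensions of `s` realizing the pattern `p`. -/
def ext1 (f : Coloring) (p : Pattern) (H : Set ℕ) (s : ℕ → ℕ) : Set ℕ :=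
  {y | y ∈ H ∧ SeqReal f (p.len - 1) p.color H s ∧
    ∀ i < p.len - 1, s i < y ∧ f (s i) y = p.color i (p.len - 1)}

theorem avoids_join_subset (p q : Pattern) (hp : 1 ≤ p.len) (hq : 1 ≤ q.len)
    (f : Coloring) (H : Set ℕ) (hH : H.Infinite) (hav : Avoids f (p.join q) H) :
    ∃ Y ⊆ H, Y.Infinite ∧ (Avoids f p Y ∨ Avoids f q Y) := by
  by_cases hex : ∃ s, (ext1 f p H s).Infinite
  · obtain ⟨s, hs⟩ := hex
    refine ⟨ext1 f p H s, fun y hy => hy.1, hs, Or.inr ?_⟩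
    rw [avoids_iff] at hav ⊢
    rintro u ⟨hu1, hu2⟩
    obtain ⟨y0, -, ⟨hs1, hs2⟩, -⟩ := hs.nonempty
    refine hav (fun i => if i < p.len - 1 then s i else u (i + 1 - p.len)) ⟨?_, ?_⟩
    · intro i hi
      simp only [Pattern.join] at hi
      dsimp only
      split_ifs with h
      · exact hs1 i h
      · exact (hu1 _ (by omega)).1
    · intro i j hij hj
      simp only [Pattern.join] at hj ⊢
      by_cases h1 : j < p.len - 1
      · have h2 : i < p.len - 1 := by omega
        have h3 : j < p.len := by omega
        simp only [h1, h2, h3, if_true]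
        exact hs2 i j hij h1
      · by_cases h2 : i < p.len - 1
        · have h4 := (hu1 (j + 1 - p.len) (by omega)).2.2 i h2
          simp only [h1, h2, if_true, if_false]
          refine ⟨h4.1, ?_⟩
          rw [h4.2]
          by_cases h3 : j < p.len
          · have : j = p.len - 1 := by omega
            rw [if_pos h3, this]
          · have h5 : ¬ (p.len - 1 ≤ i) := by omega
            simp only [h3, h5, if_false]
        · have h3 : ¬ j < p.len := by omega
          have h5 : p.len - 1 ≤ i := by omega
          simp only [h1, h2, h3, h5, if_true, if_false]
          exact hu2 _ _ (by omega) (by omega)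
  · have hfin : ∀ s, (ext1 f p H s).Finite := by
      intro s
      by_contra h
      exact hex ⟨s, h⟩
    have hB : ∀ N : ℕ, ∃ B, ∀ s : ℕ → ℕ, (∀ i < p.len - 1, s i ≤ N) →
        ∀ y ∈ ext1 f p H s, y < B := by
      intro N
      let e : (Fin (p.len - 1) → Fin (N + 1)) → ℕ → ℕ :=
        fun t i => if h : i < p.len - 1 then (t ⟨i, h⟩ : ℕ) else 0
      have hf : (⋃ t, ext1 f p H (e t)).Finite := Set.finite_iUnion (fun t => hfin _)
      obtain ⟨B, hB⟩ := hf.bddAbove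
      refine ⟨B + 1, fun s hs y hy => Nat.lt_succ_of_le (hB ?_)⟩
      refine Set.mem_iUnion.2 ⟨fun i => ⟨s i, by have := hs i i.2; omega⟩, ?_⟩
      have he : ∀ i < p.len - 1,
          e (fun i => ⟨s i, by have := hs i i.2; omega⟩) i = s i := by
        intro i hi
        simp [e, hi]
      obtain ⟨hy1, ⟨hy2, hy3⟩, hy4⟩ := hy
      refine ⟨hy1, ⟨fun i hi => ?_, fun i j hij hj => ?_⟩, fun i hi => ?_⟩
      · rw [he i hi]; exact hy2 i hi
      · rw [he i (by omega), he j hj]; exact hy3 i j hij hj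
      · rw [he i hi]; exact hy4 i hi
    choose B hB using hB
    have hnext : ∀ n : ℕ, ∃ m ∈ H, max n (B n) < m := fun n => hH.exists_gt _
    choose g hgH hg using hnext
    let a : ℕ → ℕ := fun n => g^[n] (g 0)
    have ha : ∀ n, a (n + 1) = g (a n) := fun n => Function.iterate_succ_apply' g n _
    have hmono : StrictMono a := strictMono_nat_of_lt_succ (fun n => by
      rw [ha]; exact lt_of_le_of_lt (le_max_left _ _) (hg (a n)))
    have haH : ∀ n, a n ∈ H := by
      intro n
      cases n with
      | zero => exact hgH 0
      | succ n => rw [ha]; exact hgH _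
    have hsub : Set.range a ⊆ H := by rintro _ ⟨n, rfl⟩; exact haH n
    refine ⟨Set.range a, hsub, Set.infinite_range_of_injective hmono.injective, Or.inl ?_⟩
    rw [avoids_iff]
    rintro s ⟨hs1, hs2⟩
    have hext : s (p.len - 1) ∈ ext1 f p H s :=
      ⟨hsub (hs1 _ (by omega)), ⟨fun i hi => hsub (hs1 i (by omega)),
        fun i j hij hj => hs2 i j hij (by omega)⟩, fun i hi => hs2 i _ hi (by omega)⟩
    obtain ⟨m, hm⟩ := hs1 (p.len - 1) (by omega)
    cases m with
    | zero =>
      -- then the pattern has length one, and `ext1` would be infinite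
      have hk : p.len - 1 = 0 := by
        by_contra hk
        obtain ⟨l, hl⟩ := hs1 0 (by omega)
        have := (hs2 0 (p.len - 1) (by omega) (by omega)).1
        rw [← hl, ← hm] at this
        have := hmono.lt_iff_lt.1 this
        omega
      refine hH ((hfin s).subset (fun y hy => ⟨hy, ⟨?_, ?_⟩, ?_⟩))
      all_goals intros; omega
    | succ m =>
      have h1 := hB (a m) s (fun i hi => by
        obtain ⟨l, hl⟩ := hs1 i (by omega)
        have := (hs2 i (p.len - 1) hi (by omega)).1
        rw [← hl, ← hm] at this
        have := hmono.lt_iff_lt.1 this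
        rw [← hl]
        exact hmono.monotone (by omega)) _ hext
      rw [← hm, ha] at h1
      have h2 := lt_of_le_of_lt (le_max_right _ _) (hg (a m))
      omega
end

section
/- Let p be a pattern of length ℓ ≥ 2, f a coloring, and g : ℕ → {0,1}. Let E < F be two sets with F nonempty such that F f-stabilizes E with witness g. Then E (f,g)-avoids p if and only if for every y ∈ F, the set E ∪ {y} f-avoids p. -/
theorem sort_insert_top (G : Finset ℕ) (y : ℕ) (h : ∀ x ∈ G, x < y) :
    (insert y G).sort (· ≤ ·) = G.sort (· ≤ ·) ++ [y] := by
  have hy : y ∉ G := fun hy => lt_irrefl _ (h y hy)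
  apply List.Perm.eq_of_pairwise' (r := (· ≤ ·))
  · exact Finset.pairwise_sort _ _
  · rw [List.pairwise_append]
    refine ⟨Finset.pairwise_sort _ _, by simp, ?_⟩
    intro a ha b hb
    simp only [Finset.mem_sort, List.mem_singleton] at ha hb
    subst hb
    exact (h a ha).le
  · rw [List.perm_ext_iff_of_nodup (Finset.sort_nodup _ _)]
    · intro a
      simp [or_comm]
    · rw [List.nodup_append]
      refine ⟨Finset.sort_nodup _ _, by simp, ?_⟩
      intro a ha b hb
      simp only [Finset.mem_sort, List.mem_singleton] at ha hb
      subst hb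
      exact (h a ha).ne

theorem nthElt_insert_lt (G : Finset ℕ) (y : ℕ) (h : ∀ x ∈ G, x < y) (i : ℕ)
    (hi : i < G.card) : nthElt (insert y G) i = nthElt G i := by
  unfold nthElt
  rw [sort_insert_top G y h, List.getD_append]
  simpa using hi

theorem nthElt_insert_top (G : Finset ℕ) (y : ℕ) (h : ∀ x ∈ G, x < y) :
    nthElt (insert y G) G.card = y := by
  unfold nthElt
  rw [sort_insert_top G y h, List.getD_append_right] <;> simp

theorem nthElt_mem (G : Finset ℕ) (i : ℕ) (hi : i < G.card) : nthElt G i ∈ G := by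
  have hl : i < (G.sort (· ≤ ·)).length := by simpa using hi
  unfold nthElt
  rw [List.getD_eq_getElem _ _ hl]
  exact (Finset.mem_sort (· ≤ ·)).1 (List.getElem_mem hl)

/-- Realization of `p` by a set with a new top element. -/
theorem realizes_insert_iff (p : Pattern) (hp : 2 ≤ p.len) (f : Coloring)
    (G : Finset ℕ) (y : ℕ) (h : ∀ x ∈ G, x < y) :
    Realizes f p (insert y G) ↔
      Realizes f p.minus G ∧ ∀ i < p.len - 1, f (nthElt G i) y = p.color i (p.len - 1) := by
  have hy : y ∉ G := fun hy => lt_irrefl _ (h y hy)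
  have hc : (insert y G).card = G.card + 1 := Finset.card_insert_of_notMem hy
  have htop := nthElt_insert_top G y h
  have hlt := nthElt_insert_lt G y h
  unfold Realizes Pattern.minus
  simp only
  rw [hc]
  constructor
  · rintro ⟨h1, h2⟩
    have h3 : p.len - 1 = G.card := by omega
    refine ⟨⟨by omega, fun i j hij hj => ?_⟩, fun i hi => ?_⟩
    · rw [← hlt i (by omega), ← hlt j (by omega)]
      exact h2 i j hij (by omega)
    · have := h2 i (p.len - 1) hi (by omega)
      rwa [h3, htop, hlt i (by omega), ← h3] at this
  · rintro ⟨⟨h1, h2⟩, h3⟩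
    refine ⟨by omega, fun i j hij hj => ?_⟩
    rcases Nat.lt_or_ge j (p.len - 1) with hj' | hj'
    · rw [hlt i (by omega), hlt j (by omega)]
      exact h2 i j hij hj'
    · have hje : j = G.card := by omega
      have := h3 i (by omega)
      rw [← h1] at this
      rw [hje, htop, hlt i (by omega)]
      exact this

theorem fgAvoids_iff_union_singleton_avoids (p : Pattern) (hp : 2 ≤ p.len)
    (f : Coloring) (g : ℕ → Fin 2) (E F : Set ℕ)
    (hEF : ∀ x ∈ E, ∀ y ∈ F, x < y) (hF : F.Nonempty)
    (hstab : Stabilizes f E F g) :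
    FGAvoids f g p E ↔ ∀ y ∈ F, Avoids f p (E ∪ {y}) := by
  constructor
  · rintro ⟨hA, hB⟩ y hy G hG hR
    by_cases hyG : y ∈ G
    · have hsub : ↑(G.erase y) ⊆ E := by
        intro x hx
        simp only [Finset.coe_erase, Set.mem_diff, Set.mem_singleton_iff, Finset.mem_coe] at hx
        rcases hG hx.1 with h | h
        · exact h
        · exact absurd h hx.2
      have hlt : ∀ x ∈ G.erase y, x < y := fun x hx => hEF x (hsub hx) y hy
      rw [← Finset.insert_erase hyG, realizes_insert_iff p hp f _ y hlt] at hR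
      obtain ⟨hR1, hR2⟩ := hR
      obtain ⟨i, hi, hne⟩ := hB _ hsub hR1
      apply hne
      rw [← hR2 i hi]
      exact (hstab _ (hsub (nthElt_mem _ i (lt_of_lt_of_eq hi hR1.1.symm))) y hy).symm
    · refine hA G (fun x hx => ?_) hR
      rcases hG hx with h | h
      · exact h
      · rw [Set.mem_singleton_iff] at h
        subst h
        exact absurd hx hyG
  · intro h
    obtain ⟨y, hy⟩ := hF
    refine ⟨fun G hG => h y hy G (hG.trans Set.subset_union_left), fun G hG hR => ?_⟩
    by_contra hcon
    push Not at hcon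
    have hlt : ∀ x ∈ G, x < y := fun x hx => hEF x (hG hx) y hy
    refine h y hy (insert y G) ?_ ((realizes_insert_iff p hp f G y hlt).2 ⟨hR, fun i hi => ?_⟩)
    · intro x hx
      rcases Finset.mem_insert.1 (Finset.mem_coe.1 hx) with h | h
      · exact Or.inr h
      · exact Or.inl (hG h)
    · rw [← hcon i hi]
      exact hstab _ (hG (nthElt_mem _ i (lt_of_lt_of_eq hi hR.1.symm))) y hy
end

section
/- Let p be an irreducible pattern of length ℓ ≥ 2, f a coloring, and g : ℕ → {0,1}. Let E < F be two sets such that F f-stabilizes E with witness g, and such that E and F both (f,g)-avoid p. Then E ∪ F (f,g)-avoids p. -/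
theorem nthElt_eq_emb (G : Finset ℕ) (n : ℕ) (h : G.card = n) (i : ℕ) (hi : i < n) :
    nthElt G i = G.orderEmbOfFin h ⟨i, hi⟩ := by
  subst h
  simp [nthElt, Finset.orderEmbOfFin_apply, hi]

theorem nthElt_lt (G : Finset ℕ) (i j : ℕ) (hij : i < j) (hj : j < G.card) :
    nthElt G i < nthElt G j := by
  rw [nthElt_eq_emb G _ rfl i (hij.trans hj), nthElt_eq_emb G _ rfl j hj]
  exact (G.orderEmbOfFin rfl).strictMono hij

theorem nthElt_image_s7 (x : ℕ → ℕ) (n : ℕ) (hx : ∀ i j, i < j → j < n → x i < x j) :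
    ((Finset.range n).image x).card = n ∧
      ∀ i < n, nthElt ((Finset.range n).image x) i = x i := by
  have hc : ((Finset.range n).image x).card = n := by
    rw [Finset.card_image_of_injOn, Finset.card_range]
    intro a ha b hb hab
    simp only [Finset.coe_range, Set.mem_Iio] at ha hb
    rcases lt_trichotomy a b with h | h | h
    · have := hx a b h hb
      omega
    · exact h
    · have := hx b a h ha
      omega
  refine ⟨hc, fun i hi => ?_⟩
  rw [nthElt_eq_emb _ n hc i hi]
  have := Finset.orderEmbOfFin_unique hc (f := fun i : Fin n => x i)
    (fun i => Finset.mem_image_of_mem _ (Finset.mem_range.2 i.2))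
    (fun a b hab => hx a b hab b.2)
  rw [← this]

theorem irr_split (p : Pattern) (hirr : p.Irreducible) (k : ℕ) (hk : 1 ≤ k)
    (hk2 : k + 2 ≤ p.len) (c : ℕ → Fin 2)
    (h : ∀ x y, x < k → k ≤ y → y < p.len → p.color x y = c x) : False := by
  apply hirr
  refine ⟨⟨k + 1, p.color⟩, ⟨p.len - k, fun x y => p.color (x + k) (y + k)⟩,
    by simp; omega, by simp; omega, by simp [Pattern.join]; omega, ?_⟩
  intro x y hxy hy
  simp only [Pattern.join]
  split_ifs with h1 h2
  · rfl
  · congr 1 <;> omega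
  · rw [h x y (by omega) (by omega) hy, Nat.add_sub_cancel, h x k (by omega) le_rfl (by omega)]

theorem exists_split (E F : Set ℕ) (hEF : ∀ x ∈ E, ∀ y ∈ F, x < y) (n : ℕ) (x : ℕ → ℕ)
    (hx : ∀ i j, i < j → j < n → x i < x j) (hm : ∀ i < n, x i ∈ E ∪ F) :
    ∃ k ≤ n, (∀ i < k, x i ∈ E) ∧ ∀ i, k ≤ i → i < n → x i ∈ F := by
  classical
  have hex : ∃ k, n ≤ k ∨ x k ∉ E := ⟨n, Or.inl le_rfl⟩
  refine ⟨Nat.find hex, Nat.find_min' hex (Or.inl le_rfl), fun i hi => ?_, fun i hi hin => ?_⟩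
  · have := Nat.find_min hex hi
    push Not at this
    exact this.2
  · have hs := Nat.find_spec hex
    generalize Nat.find hex = k at hi hs
    have hkE : x k ∉ E := hs.resolve_left (by omega)
    have hkF : x k ∈ F := (hm k (by omega)).resolve_left hkE
    rcases hi.eq_or_lt with h | h
    · exact h ▸ hkF
    · refine (hm i hin).resolve_left fun hiE => ?_
      have h1 := hEF _ hiE _ hkF
      have h2 := hx k i h hin
      omega

theorem fgAvoids_union_of_irreducible (p : Pattern) (hp : 2 ≤ p.len)
    (hirr : p.Irreducible) (f : Coloring) (g : ℕ → Fin 2) (E F : Set ℕ)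
    (hEF : ∀ x ∈ E, ∀ y ∈ F, x < y) (hstab : Stabilizes f E F g)
    (hE : FGAvoids f g p E) (hF : FGAvoids f g p F) :
    FGAvoids f g p (E ∪ F) := by
  have hsub : ∀ (G : Finset ℕ) (X : Set ℕ), (∀ i < G.card, nthElt G i ∈ X) → ↑G ⊆ X := by
    intro G X h y hy
    have : y ∈ Set.range (G.orderEmbOfFin rfl) := by
      rw [Finset.range_orderEmbOfFin]; exact hy
    obtain ⟨i, rfl⟩ := this
    have := h i i.2
    rwa [nthElt_eq_emb G _ rfl i i.2] at this
  constructor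
  · intro G hG hr
    obtain ⟨hc, hr⟩ := id hr
    obtain ⟨k, hk, h1, h2⟩ := exists_split E F hEF p.len (nthElt G)
      (fun i j hij hj => nthElt_lt G i j hij (by omega))
      (fun i hi => hG (nthElt_mem G i (by omega)))
    by_cases hk0 : k = 0
    · exact hF.1 G (hsub G F fun i hi => h2 i (by omega) (by omega)) ⟨hc, hr⟩
    by_cases hkl : k = p.len
    · exact hE.1 G (hsub G E fun i hi => h1 i (by omega)) ⟨hc, hr⟩
    by_cases hkl1 : k = p.len - 1
    · obtain ⟨hc', he⟩ := nthElt_image_s7 (nthElt G) (p.len - 1)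
        (fun i j hij hj => nthElt_lt G i j hij (by omega))
      obtain ⟨i, hi, hne⟩ := hE.2 ((Finset.range (p.len - 1)).image (nthElt G))
        (hsub _ E fun i hi => by rw [he i (by omega)]; exact h1 i (by omega))
        ⟨hc', fun i j hij hj => by
          simp only [Pattern.minus] at hj ⊢
          rw [he i (by omega), he j hj]
          exact hr i j hij (by omega)⟩
      apply hne
      rw [he i hi, ← hr i (p.len - 1) hi (by omega)]
      exact (hstab _ (h1 i (by omega)) _ (h2 _ (by omega) (by omega))).symm
    · refine irr_split p hirr k (by omega) (by omega) (fun i => g (nthElt G i)) ?_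
      intro x y hx hy hyl
      rw [← hr x y (by omega) hyl]
      exact hstab _ (h1 x hx) _ (h2 y hy hyl)
  · intro G hG hr
    by_contra hcon
    push Not at hcon
    obtain ⟨hc, hr'⟩ := id hr
    simp only [Pattern.minus] at hc hr'
    obtain ⟨k, hk, h1, h2⟩ := exists_split E F hEF (p.len - 1) (nthElt G)
      (fun i j hij hj => nthElt_lt G i j hij (by omega))
      (fun i hi => hG (nthElt_mem G i (by omega)))
    by_cases hk0 : k = 0
    · obtain ⟨i, hi, hne⟩ := hF.2 G (hsub G F fun i hi => h2 i (by omega) (by omega)) hr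
      exact hne (hcon i hi)
    by_cases hkl : k = p.len - 1
    · obtain ⟨i, hi, hne⟩ := hE.2 G (hsub G E fun i hi => h1 i (by omega)) hr
      exact hne (hcon i hi)
    · refine irr_split p hirr k (by omega) (by omega) (fun i => g (nthElt G i)) ?_
      intro x y hx hy hyl
      by_cases hyy : y = p.len - 1
      · subst hyy
        exact (hcon x (by omega)).symm
      · rw [← hr' x y (by omega) (by omega)]
        exact hstab _ (h1 x hx) _ (h2 y hy (by omega))
end

section
/- Fix i < 2 and let p be a pattern of length ℓ ≥ 2 which is divergent and i-merging. Let f be a coloring and g : ℕ → {0,1}. Let E < F be two sets such that: (1) E is g-homogeneous and F is g-homogeneous for color 1−i; (2) for every x₀, x₁ ∈ E and every y₀, y₁ ∈ F, f(x₀, y₀) = f(x₁, y₁); (3) E ∪ F f-avoids p. Then E ∪ F (f,g)-avoids p. -/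
theorem nthElt_mem_aux (H : Finset ℕ) (k : ℕ) (hk : k < H.card) : nthElt H k ∈ H := by
  have h : k < (H.sort (· ≤ ·)).length := by simpa using hk
  unfold nthElt
  rw [List.getD_eq_getElem _ _ h]
  exact (Finset.mem_sort (· ≤ ·)).1 (List.getElem_mem h)

theorem nthElt_mono_aux (H : Finset ℕ) (j k : ℕ) (hjk : j ≤ k) (hk : k < H.card) :
    nthElt H j ≤ nthElt H k := by
  have h : k < (H.sort (· ≤ ·)).length := by simpa using hk
  have h' : j < (H.sort (· ≤ ·)).length := lt_of_le_of_lt hjk h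
  unfold nthElt
  rw [List.getD_eq_getElem _ _ h, List.getD_eq_getElem _ _ h']
  rcases hjk.eq_or_lt with rfl | hlt
  · exact le_rfl
  · exact List.pairwise_iff_getElem.1 (Finset.pairwise_sort H (· ≤ ·)) j k h' h hlt

theorem fgAvoids_union_of_merging (i : Fin 2) (p : Pattern) (hp : 2 ≤ p.len)
    (hdiv : p.Divergent) (hmerge : p.Merging i)
    (f : Coloring) (g : ℕ → Fin 2) (E F : Set ℕ)
    (hEF : ∀ x ∈ E, ∀ y ∈ F, x < y)
    (hEhom : ∃ c : Fin 2, ∀ x ∈ E, g x = c)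
    (hFhom : ∀ y ∈ F, g y = 1 - i)
    (hconst : ∀ x₀ ∈ E, ∀ x₁ ∈ E, ∀ y₀ ∈ F, ∀ y₁ ∈ F, f x₀ y₀ = f x₁ y₁)
    (hav : Avoids f p (E ∪ F)) :
    FGAvoids f g p (E ∪ F) := by
  classical
  refine ⟨hav, fun H hH hreal => ?_⟩
  by_contra hcon
  push Not at hcon
  obtain ⟨c, hc⟩ := hEhom
  obtain ⟨hcard, hcol⟩ := hreal
  change H.card = p.len - 1 at hcard
  change ∀ a b, a < b → b < p.len - 1 → f (nthElt H a) (nthElt H b) = p.color a b at hcol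
  have hmem : ∀ k < p.len - 1, nthElt H k ∈ E ∨ nthElt H k ∈ F := fun k hk =>
    hH (nthElt_mem_aux H k (by omega))
  let A := (Finset.range (p.len - 1)).filter (fun k => nthElt H k ∈ E)
  let B := (Finset.range (p.len - 1)).filter (fun k => nthElt H k ∉ E)
  have hA : ∀ k ∈ A, k < p.len - 1 ∧ nthElt H k ∈ E := fun k hk => by simpa [A] using hk
  have hB : ∀ k ∈ B, k < p.len - 1 ∧ nthElt H k ∈ F := fun k hk => by
    have h : k < p.len - 1 ∧ nthElt H k ∉ E := by simpa [B] using hk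
    exact ⟨h.1, (hmem k h.1).resolve_left h.2⟩
  have hAB : ∀ x ∈ A, ∀ y ∈ B, x < y := by
    intro x hx y hy
    by_contra hle
    have h1 := hEF _ (hA x hx).2 _ (hB y hy).2
    have h2 := nthElt_mono_aux H y x (by omega) (by have := (hA x hx).1; omega)
    omega
  by_cases hAne : A.Nonempty
  swap
  · apply hdiv
    refine ⟨1 - i, fun x hx => ?_⟩
    rw [← hcon x hx]
    apply hFhom
    refine (hmem x hx).resolve_left fun h => hAne ⟨x, ?_⟩
    simp [A, hx, h]
  by_cases hBne : B.Nonempty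
  swap
  · apply hdiv
    refine ⟨c, fun x hx => ?_⟩
    rw [← hcon x hx]
    apply hc
    by_contra h
    exact hBne ⟨x, by simp [B, hx, h]⟩
  rcases hmerge A B hAne hBne (Finset.disjoint_filter_filter_not _ _ _)
    (Finset.filter_union_filter_not_eq _ _) hAB with
    ⟨x, hx, h⟩ | ⟨x, hx, h⟩ | ⟨x₀, hx₀, x₁, hx₁, y₀, hy₀, y₁, hy₁, h⟩
  · have hci : c = 1 - i := by
      rw [← h, ← hcon x (hA x hx).1, hc _ (hA x hx).2]
    apply hdiv
    refine ⟨1 - i, fun z hz => ?_⟩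
    rw [← hcon z hz]
    rcases hmem z hz with h' | h'
    · rw [hc _ h', hci]
    · exact hFhom _ h'
  · have h1 : (1 : Fin 2) - i = i := by
      rw [← hFhom _ (hB x hx).2, hcon x (hB x hx).1, h]
    exact absurd h1 ((by decide : ∀ j : Fin 2, (1 : Fin 2) - j ≠ j) i)
  · apply h
    rw [← hcol _ _ (hAB _ hx₀ _ hy₀) (hB _ hy₀).1, ← hcol _ _ (hAB _ hx₁ _ hy₁) (hB _ hy₁).1]
    exact hconst _ (hA _ hx₀).2 _ (hA _ hx₁).2 _ (hB _ hy₀).2 _ (hB _ hy₁).2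
end

section
/- Let p be a pattern of length ℓ and F ⊔ G = {0,…,ℓ−1} a partition with F nonempty, G of cardinality at least 2, max F < min G, and such that p(x,y) = p(x,z) for all x ∈ F and all y, z ∈ G. Let f be a stable coloring and write z₀ = min G. Suppose R is a finite set strongly f-realizing p↾_{F ∪ {z₀}}, S is a finite set strongly f-realizing p↾_G, max R < min S, and every element of R has reached its limit on S (i.e., for every x ∈ R and y ∈ S, f(x,y) equals the eventual value of f(x,·)). Then R ∪ S strongly f-realizes p. -/
theorem nthElt_union {A B : Finset ℕ} (h : ∀ x ∈ A, ∀ y ∈ B, x < y) (i : ℕ) :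
    nthElt (A ∪ B) i = if i < A.card then nthElt A i else nthElt B (i - A.card) := by
  have hs : (A ∪ B).sort (· ≤ ·) = A.sort (· ≤ ·) ++ B.sort (· ≤ ·) := by
    apply List.Perm.eq_of_pairwise (le := (· ≤ ·))
    · intro a b _ _ h1 h2
      exact le_antisymm h1 h2
    · exact Finset.pairwise_sort _ _
    · rw [List.pairwise_append]
      refine ⟨Finset.pairwise_sort _ _, Finset.pairwise_sort _ _, ?_⟩
      intro a ha b hb
      exact (h a (by simpa using ha) b (by simpa using hb)).le
    · rw [List.perm_ext_iff_of_nodup (Finset.sort_nodup _ _)]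
      · intro a
        simp
      · rw [List.nodup_append]
        refine ⟨Finset.sort_nodup _ _, Finset.sort_nodup _ _, ?_⟩
        intro a ha b hb
        exact (h a (by simpa using ha) b (by simpa using hb)).ne
  unfold nthElt
  rw [hs]
  split_ifs with hi
  · rw [List.getD_append _ _ _ _ (by simpa using hi)]
  · rw [List.getD_append_right _ _ _ _ (by simpa using hi)]
    simp

theorem nthElt_mem_s15 {A : Finset ℕ} {i : ℕ} (h : i < A.card) : nthElt A i ∈ A := by
  have h' : i < (A.sort (· ≤ ·)).length := by simpa using h
  unfold nthElt
  rw [List.getD_eq_getElem _ _ h']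
  exact (Finset.mem_sort (· ≤ ·)).1 (List.getElem_mem h')

theorem nthElt_singleton (a : ℕ) : nthElt {a} 0 = a := by
  simp [nthElt]

theorem nthElt_range (n : ℕ) : ∀ i < n, nthElt (Finset.range n) i = i := by
  induction n with
  | zero => simp
  | succ n ih =>
    intro i hi
    have e : Finset.range (n + 1) = Finset.range n ∪ {n} := by
      ext x
      simp
      omega
    rw [e, nthElt_union (by simp)]
    simp only [Finset.card_range]
    split_ifs with h
    · exact ih i h
    · have : i = n := by omega
      subst this
      simp [nthElt_singleton]

theorem stronglyRealizes_union (p : Pattern) (F G : Finset ℕ)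
    (hF : F.Nonempty) (hG : 2 ≤ G.card) (hdisj : Disjoint F G)
    (hunion : F ∪ G = Finset.range p.len)
    (hlt : ∀ x ∈ F, ∀ y ∈ G, x < y)
    (hconst : ∀ x ∈ F, ∀ y ∈ G, ∀ z ∈ G, p.color x y = p.color x z)
    (f : Coloring) (hf : Stable f) (R S : Finset ℕ)
    (hR : StronglyRealizes f
      (p.restrict (insert (G.min' (Finset.card_pos.mp (by omega))) F)) R)
    (hS : StronglyRealizes f (p.restrict G) S)
    (hRS : ∀ x ∈ R, ∀ y ∈ S, x < y)
    (hlimit : ∀ x ∈ R, ∀ y ∈ S, ∃ N, ∀ z ≥ N, f x z = f x y) :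
    StronglyRealizes f p (R ∪ S) := by 
  have hGne : G.Nonempty := Finset.card_pos.mp (by omega)
  have hz : G.min' hGne ∈ G := Finset.min'_mem _ _
  generalize G.min' hGne = z at hz hR
  have hlen : F.card + G.card = p.len := by
    rw [← Finset.card_union_of_disjoint hdisj, hunion, Finset.card_range]
  have hFi : ∀ i < F.card, nthElt F i = i := by
    intro i hi
    have h1 := nthElt_union hlt i
    rw [hunion, nthElt_range _ _ (by omega), if_pos hi] at h1
    exact h1.symm
  have hGi : ∀ i < G.card, nthElt G i = F.card + i := by
    intro i hi
    have h1 := nthElt_union hlt (F.card + i)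
    rw [hunion, nthElt_range _ _ (by omega), if_neg (by omega), Nat.add_sub_cancel_left] at h1
    exact h1.symm
  have hFm : ∀ i < F.card, i ∈ F := fun i hi => hFi i hi ▸ nthElt_mem_s15 hi
  have hGm : ∀ i, F.card ≤ i → i < p.len → i ∈ G := by
    intro i h1 h2
    have h3 := nthElt_mem_s15 (A := G) (i := i - F.card) (by omega)
    rw [hGi _ (by omega)] at h3
    have : F.card + (i - F.card) = i := by omega
    rwa [this] at h3
  have hins : insert z F = F ∪ {z} := by
    ext x
    simp [or_comm]
  have hFz : ∀ x ∈ F, ∀ y ∈ ({z} : Finset ℕ), x < y := by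
    intro x hx y hy
    rw [Finset.mem_singleton] at hy
    exact hy ▸ hlt x hx z hz
  have hzF : z ∉ F := fun h => lt_irrefl _ (hlt z h z hz)
  have hcard : (insert z F).card = F.card + 1 := Finset.card_insert_of_notMem hzF
  have hIi : ∀ i < F.card, nthElt (insert z F) i = i := by
    intro i hi
    rw [hins, nthElt_union hFz, if_pos hi, hFi i hi]
  have hIz : nthElt (insert z F) F.card = z := by
    rw [hins, nthElt_union hFz, if_neg (lt_irrefl _), Nat.sub_self, nthElt_singleton]
  obtain ⟨⟨hRc, hRp⟩, hRl⟩ := hR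
  obtain ⟨⟨hSc, hSp⟩, hSl⟩ := hS
  simp only [Pattern.minus, Pattern.restrict, hcard, Nat.add_sub_cancel] at hRc hRp hRl hSc hSp hSl
  have hdRS : Disjoint R S := Finset.disjoint_left.2 fun x h1 h2 => lt_irrefl _ (hRS x h1 x h2)
  have hL : ∀ i < F.card, ∀ j ∈ G, ∃ N, ∀ y ≥ N, f (nthElt R i) y = p.color i j := by
    intro i hi j hj
    obtain ⟨N, hN⟩ := hRl i hi
    refine ⟨N, fun y hy => ?_⟩
    rw [hN y hy, hIz, hIi i hi]
    exact hconst i (hFm i hi) z hz j hj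
  refine ⟨⟨?_, ?_⟩, ?_⟩
  · simp only [Pattern.minus]
    rw [Finset.card_union_of_disjoint hdRS]
    omega
  · intro i j hij hj
    simp only [Pattern.minus] at hj ⊢
    rw [nthElt_union hRS, nthElt_union hRS, hRc]
    by_cases hjF : j < F.card
    · rw [if_pos (by omega), if_pos hjF, hRp i j hij hjF, hIi i (by omega), hIi j hjF]
    · rw [if_neg hjF]
      by_cases hiF : i < F.card
      · rw [if_pos hiF]
        obtain ⟨N, hN⟩ := hL i hiF j (hGm j (by omega) (by omega))
        obtain ⟨M, hM⟩ := hlimit (nthElt R i) (nthElt_mem_s15 (by omega))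
          (nthElt S (j - F.card)) (nthElt_mem_s15 (by omega))
        rw [← hM (max M N) (le_max_left _ _), hN _ (le_max_right _ _)]
      · rw [if_neg hiF, hSp _ _ (by omega) (by omega), hGi _ (by omega), hGi _ (by omega)]
        congr 1 <;> omega
  · intro i hi
    rw [nthElt_union hRS, hRc]
    by_cases hiF : i < F.card
    · rw [if_pos hiF]
      exact hL i hiF _ (hGm _ (by omega) (by omega))
    · rw [if_neg hiF]
      obtain ⟨N, hN⟩ := hSl (i - F.card) (by omega)
      refine ⟨N, fun y hy => ?_⟩
      rw [hN y hy, hGi _ (by omega), hGi _ (by omega)]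
      congr 1 <;> omega
end
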